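/- arXiv:0910.0787 — 11 statements merged into one kernel-verified Lean document; each statement's English description precedes it below -/
import Mathlib

section
/- Let p ≥ 5 be a prime, let a : ℕ × ℤ × ℕ → ZMod p be a formal degree-2 Fourier expansion mod p, and let b ∈ ZMod p with b ≠ 0. Then 𝔻^((p+1)/2) a = −(legendreSym p b) · 𝔻 a (as functions, with the Legendre symbol cast into ZMod p) if and only if a(n,r,m) = 0 for every (n,r,m) ∈ ℕ × ℤ × ℕ such that legendreSym p (4nm − r²) = legendreSym p b. (This is the formal coefficient-level content of Theorem 1.2 together with Remark 1: the criterion 𝔻^((p+1)/2)F ≡ −(b/p)𝔻F (mod p) holds if and only if F has Ramanujan-type congruences at every b' with (b'/p) = (b/p).) -/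
/-- The generalized theta operator `𝔻` acting on formal degree-2 Fourier
expansions mod `p`: `(𝔻 a)(n,r,m) = (4nm - r²) * a(n,r,m)`. -/
def thetaOp (p : ℕ) (a : ℕ × ℤ × ℕ → ZMod p) : ℕ × ℤ × ℕ → ZMod p :=
  fun t => ((4 * (t.1 : ℤ) * (t.2.2 : ℤ) - t.2.1 ^ 2 : ℤ) : ZMod p) * a t

/-- The iterates of `𝔻` multiply each coefficient by a power of `4nm - r²`. -/
theorem thetaOp_iterate_apply (p k : ℕ) (a : ℕ × ℤ × ℕ → ZMod p) (t : ℕ × ℤ × ℕ) :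
    (thetaOp p)^[k] a t =
      ((4 * (t.1 : ℤ) * (t.2.2 : ℤ) - t.2.1 ^ 2 : ℤ) : ZMod p) ^ k * a t := by
  induction k with
  | zero => simp
  | succ k ih => rw [Function.iterate_succ_apply', thetaOp, ih, pow_succ' _ k, mul_assoc (_ : ZMod p)]

/-- For `c` prime to `p`, `d ^ ((p + 1) / 2) * x = -(c / p) * (d * x)` in `ZMod p` exactly when
`x` vanishes or `d` and `c` have different Legendre symbols. -/
theorem legendreSym.pow_mul_eq_neg_mul_iff (p : ℕ) [Fact p.Prime] (hp : p ≠ 2) (c d : ℤ)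
    (hc : (c : ZMod p) ≠ 0) (x : ZMod p) :
    (d : ZMod p) ^ ((p + 1) / 2) * x = -(legendreSym p c : ZMod p) * (d * x) ↔
      (legendreSym p d = legendreSym p c → x = 0) := by
  have hodd := (Fact.out : p.Prime).eq_two_or_odd.resolve_left hp
  have hexp : (p + 1) / 2 = p / 2 + 1 := by lia
  have h2 : (2 : ZMod p) ≠ 0 := Ring.two_ne_zero (by rwa [ZMod.ringChar_zmod_n])
  rw [hexp, pow_succ, ← legendreSym.eq_pow]
  by_cases hd : (d : ZMod p) = 0
  · have hd' := (legendreSym.eq_zero_iff p d).2 hd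
    have hc' := mt (legendreSym.eq_zero_iff p c).1 hc
    simp [hd, hd', Ne.symm hc']
  · have key : (legendreSym p d : ZMod p) * d * x = -(legendreSym p c : ZMod p) * (d * x) ↔
        ((legendreSym p d : ZMod p) + legendreSym p c) * (d * x) = 0 := by
      rw [← sub_eq_zero]
      ring_nf
    rw [key]
    rcases legendreSym.eq_one_or_neg_one p hd with h | h <;>
    rcases legendreSym.eq_one_or_neg_one p hc with h' | h' <;>
    norm_num [h, h', hd, h2]

theorem stmt_0 (p : ℕ) [Fact p.Prime] (hp5 : 5 ≤ p)
    (a : ℕ × ℤ × ℕ → ZMod p) (b : ZMod p) (hb : b ≠ 0) :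
    (thetaOp p)^[(p + 1) / 2] a
        = (fun t => -((legendreSym p (b.val : ℤ) : ZMod p)) * thetaOp p a t)
      ↔ ∀ (n : ℕ) (r : ℤ) (m : ℕ),
          legendreSym p (4 * (n : ℤ) * (m : ℤ) - r ^ 2) = legendreSym p (b.val : ℤ) →
          a (n, r, m) = 0 := by
  rw [funext_iff]
  simp only [thetaOp_iterate_apply, Prod.forall]
  simp only [thetaOp]
  exact forall₃_congr fun n r m =>
    legendreSym.pow_mul_eq_neg_mul_iff p (by lia) _ _ (by simpa using hb) _
end

section
/- Let p ≥ 5 be a prime, m ∈ ℕ, let c : ℕ × ℤ → ZMod p be a formal Jacobi–Fourier expansion mod p, and let b ∈ ZMod p with b ≠ 0. Then L_m^((p+1)/2) c = −(legendreSym p b) · L_m c (as functions, with the Legendre symbol cast into ZMod p) if and only if c(n,r) = 0 for every (n,r) ∈ ℕ × ℤ such that legendreSym p (4nm − r²) = legendreSym p b. (This is the formal coefficient-level content of Proposition 2.4: L_m^((p+1)/2)φ ≡ −(b/p)L_m φ (mod p) holds if and only if φ has Ramanujan-type congruences at every b' with (b'/p) = (b/p).) -/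
/-- The heat operator `L_m` acting on formal Jacobi–Fourier expansions mod `p`:
`(L_m c)(n,r) = (4nm - r²) * c(n,r)`. -/
def heatOp (p m : ℕ) (c : ℕ × ℤ → ZMod p) : ℕ × ℤ → ZMod p :=
  fun t => ((4 * (t.1 : ℤ) * (m : ℤ) - t.2 ^ 2 : ℤ) : ZMod p) * c t

theorem heatOp_iterate_apply (p m k : ℕ) (c : ℕ × ℤ → ZMod p) (t : ℕ × ℤ) :
    (heatOp p m)^[k] c t
      = ((4 * (t.1 : ℤ) * (m : ℤ) - t.2 ^ 2 : ℤ) : ZMod p) ^ k * c t := by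
  induction k with
  | zero => simp
  | succ k ih =>
    rw [Function.iterate_succ_apply', heatOp, ih, ← mul_assoc, ← pow_succ']

theorem pow_mul_eq_neg_legendreSym_mul_iff {p : ℕ} [Fact p.Prime] (hp : p ≠ 2) {a b : ℤ}
    (hb : (b : ZMod p) ≠ 0) (x : ZMod p) :
    (a : ZMod p) ^ ((p + 1) / 2) * x = -(legendreSym p b : ZMod p) * ((a : ZMod p) * x)
      ↔ (legendreSym p a = legendreSym p b → x = 0) := by
  have hodd : p % 2 = 1 := (Fact.out : p.Prime).eq_two_or_odd.resolve_left hp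
  have hexp : (p + 1) / 2 = p / 2 + 1 := by omega
  have htwo : (2 : ZMod p) ≠ 0 := Ring.two_ne_zero (by rwa [ZMod.ringChar_zmod_n])
  have hneg (y : ZMod p) : y = -y ↔ y = 0 := by
    rw [eq_neg_iff_add_eq_zero, ← two_mul, mul_eq_zero, or_iff_right htwo]
  rw [hexp, pow_succ, ← legendreSym.eq_pow, mul_assoc]
  by_cases ha : (a : ZMod p) = 0
  · have h0 : legendreSym p a = 0 := (legendreSym.eq_zero_iff p a).2 ha
    have hne : legendreSym p b ≠ 0 := mt (legendreSym.eq_zero_iff p b).1 hb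
    simp [ha, h0, hne.symm]
  · rcases legendreSym.eq_one_or_neg_one p ha with h | h <;>
      rcases legendreSym.eq_one_or_neg_one p hb with h' | h' <;>
      simp [h, h', hneg, neg_eq_iff_eq_neg, ha]

theorem stmt_1 (p : ℕ) [Fact p.Prime] (hp5 : 5 ≤ p) (m : ℕ)
    (c : ℕ × ℤ → ZMod p) (b : ZMod p) (hb : b ≠ 0) :
    (heatOp p m)^[(p + 1) / 2] c
        = (fun t => -((legendreSym p (b.val : ℤ) : ZMod p)) * heatOp p m c t)
      ↔ ∀ (n : ℕ) (r : ℤ),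
          legendreSym p (4 * (n : ℤ) * (m : ℤ) - r ^ 2) = legendreSym p (b.val : ℤ) →
          c (n, r) = 0 := by
  have hb' : (((b.val : ℕ) : ℤ) : ZMod p) ≠ 0 := by simpa using hb
  simp only [funext_iff, Prod.forall, heatOp_iterate_apply]
  exact forall₂_congr fun n r => pow_mul_eq_neg_legendreSym_mul_iff (by omega) hb' _
end

section
/- Let p ≥ 5 be a prime, m ∈ ℕ, b ∈ ZMod p, and let c : ℕ × ℤ → ZMod p be a formal Jacobi–Fourier expansion mod p. Define the shifted heat operator (L_m − b) by ((L_m − b) c)(n,r) = ((4nm − r²) − b) · c(n,r) in ZMod p. Then c has a Ramanujan-type congruence at b if and only if (L_m − b)^(p−1) c = c. (This is the cleared-denominator form of the paper's criterion L_m^(p−1)(q^(−b/4m) φ) ≡ q^(−b/4m) φ (mod p).) -/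
/-- The shifted heat operator `L_m - b` acting on formal Jacobi–Fourier
expansions mod `p`: `((L_m - b) c)(n,r) = ((4nm - r²) - b) * c(n,r)`. -/
def shiftedHeatOp (p m : ℕ) (b : ZMod p) (c : ℕ × ℤ → ZMod p) : ℕ × ℤ → ZMod p :=
  fun t => (((4 * (t.1 : ℤ) * (m : ℤ) - t.2 ^ 2 : ℤ) : ZMod p) - b) * c t

/-- Iterating the shifted heat operator multiplies coefficients by powers of its symbol. -/
theorem shiftedHeatOp_iterate_apply (p m : ℕ) (b : ZMod p) (c : ℕ × ℤ → ZMod p) (k : ℕ)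
    (t : ℕ × ℤ) :
    (shiftedHeatOp p m b)^[k] c t =
      (((4 * (t.1 : ℤ) * (m : ℤ) - t.2 ^ 2 : ℤ) : ZMod p) - b) ^ k * c t := by
  induction k with
  | zero => simp
  | succ k ih => rw [Function.iterate_succ_apply', shiftedHeatOp, ih, ← mul_assoc, ← pow_succ']

theorem stmt_3 (p : ℕ) [Fact p.Prime] (hp5 : 5 ≤ p) (m : ℕ) (b : ZMod p)
    (c : ℕ × ℤ → ZMod p) :
    (∀ (n : ℕ) (r : ℤ), ((4 * (n : ℤ) * (m : ℤ) - r ^ 2 : ℤ) : ZMod p) = b →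
        c (n, r) = 0)
      ↔ (shiftedHeatOp p m b)^[p - 1] c = c := by
  constructor
  · intro h
    funext ⟨n, r⟩
    rw [shiftedHeatOp_iterate_apply]
    by_cases hb : ((4 * (n : ℤ) * (m : ℤ) - r ^ 2 : ℤ) : ZMod p) = b
    · rw [h n r hb, mul_zero]
    · rw [ZMod.pow_card_sub_one_eq_one (sub_ne_zero.mpr hb), one_mul]
  · intro h n r hb
    have hc := congrFun h (n, r)
    rw [shiftedHeatOp_iterate_apply, sub_eq_zero.mpr hb, zero_pow (by omega), zero_mul] at hc
    exact hc.symm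
end

section
/- Let p ≥ 5 be a prime and (Ω, s) a heat-cycle datum. Then for every j ≥ 1, Ω(j) is not congruent to (p+3)/2 modulo p. (Lemma 2.5, part 1.) -/
theorem stmt_7 (p : ℕ) (hp : p.Prime) (hp5 : 5 ≤ p)
    (Ω : ℕ → ℤ) (s : ℕ → ℕ)
    (h1 : ∀ j, 1 ≤ j → Ω (j + 1) = Ω j + ((p : ℤ) + 1) - (s j : ℤ) * ((p : ℤ) - 1))
    (h2 : ∀ j, 1 ≤ j → (1 ≤ s j ↔ Ω j ≡ (((p + 1) / 2 : ℕ) : ℤ) [ZMOD (p : ℤ)]))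
    (h3 : ∀ j, 1 ≤ j → Ω (j + (p - 1)) = Ω j) :
    ∀ j, 1 ≤ j → ¬ (Ω j ≡ (((p + 3) / 2 : ℕ) : ℤ) [ZMOD (p : ℤ)]) := by
  intro j hj hmod
  have hhalf : (p + 3) / 2 = (p + 1) / 2 + 1 := by omega
  -- The next high point is at least `p - 1` steps away, so the filtration only grows until then.
  have growth : ∀ k : ℕ, k ≤ p - 1 → Ω (j + k) = Ω j + k * ((p : ℤ) + 1) := by
    intro k
    induction k with
    | zero => simp
    | succ k ih =>
      intro hk
      have ihk := ih (by omega)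
      have hs : s (j + k) = 0 := by
        by_contra hne
        have hhigh := (h2 (j + k) (by omega)).1 (Nat.one_le_iff_ne_zero.2 hne)
        rw [ihk] at hhigh
        rw [hhalf] at hmod
        obtain ⟨a, ha⟩ := hmod.dvd
        obtain ⟨b, hb⟩ := hhigh.dvd
        have hdvd : (p : ℤ) ∣ ((k + 1 : ℕ) : ℤ) := by
          refine ⟨a - b - k, ?_⟩
          push_cast at ha hb ⊢
          linear_combination ha - hb
        have := Nat.le_of_dvd k.succ_pos (Int.natCast_dvd_natCast.1 hdvd)
        omega
      rw [← add_assoc, h1 (j + k) (by omega), ihk, hs]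
      push_cast
      ring
  have hreturn := growth (p - 1) le_rfl
  rw [h3 j hj, left_eq_add] at hreturn
  have : 0 < ((p - 1 : ℕ) : ℤ) * ((p : ℤ) + 1) :=
    mul_pos (by omega) (by omega)
  exact this.ne' hreturn
end

section
/- Let p ≥ 5 be a prime and (Ω, s) a heat-cycle datum. Then there is exactly one high point among the indices {1, 2, …, p−1} if and only if there exists j ≥ 1 with Ω(j) ≡ (p+5)/2 (mod p); moreover, every index j ≥ 2 with Ω(j) ≡ (p+5)/2 (mod p) is a low point. (Lemma 2.5, part 2: the heat cycle has a single low point if and only if some member of the cycle has filtration ≡ (p+5)/2 (mod p), and that member is the low point.) -/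
/-- For a predicate on positive integers that is periodic with period `m`, every window of
length `m` contains the same number of solutions. -/
theorem card_filter_Ico_eq_of_periodic_pos (P : ℕ → Prop) [DecidablePred P] (m : ℕ)
    (hP : ∀ j, 1 ≤ j → (P (j + m) ↔ P j)) (j : ℕ) (hj : 1 ≤ j) :
    ((Finset.Icc 1 m).filter P).card = ((Finset.Ico j (j + m)).filter P).card := by
  have hper : Function.Periodic (fun n => P (n + 1)) m := by
    intro n
    have := hP (n + 1) (by omega)
    rw [add_right_comm] at this
    exact propext this
  have shift (a : ℕ) : ((Finset.Ico (a + 1) (a + 1 + m)).filter P).card =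
      m.count (fun n => P (n + 1)) := by
    rw [← Nat.filter_Ico_card_eq_of_periodic a m _ hper, Finset.card_filter, Finset.card_filter,
      Finset.sum_Ico_add' (fun n => if P n then 1 else 0) a (a + m) 1, add_right_comm]
  obtain ⟨k, rfl⟩ : ∃ k, j = k + 1 := ⟨j - 1, by omega⟩
  rw [shift k, ← shift 0]
  congr 2
  ext x
  simp only [Finset.mem_Icc, Finset.mem_Ico]
  omega

/-- Over one full period the drops `s` add up to `p + 1`. -/
theorem sum_drops_eq (p : ℕ) (hp : 2 ≤ p) (Ω : ℕ → ℤ) (s : ℕ → ℕ)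
    (h1 : ∀ j, 1 ≤ j → Ω (j + 1) = Ω j + ((p : ℤ) + 1) - (s j : ℤ) * ((p : ℤ) - 1))
    (h3 : ∀ j, 1 ≤ j → Ω (j + (p - 1)) = Ω j) :
    ∑ j ∈ Finset.Icc 1 (p - 1), s j = p + 1 := by
  have partial_sum (n : ℕ) : Ω (1 + n) = Ω 1 + n * ((p : ℤ) + 1) -
      (∑ j ∈ Finset.Icc 1 n, (s j : ℤ)) * ((p : ℤ) - 1) := by
    induction n with
    | zero => simp
    | succ n ih =>
      rw [← add_assoc, h1 (1 + n) (by omega), ih, Finset.sum_Icc_succ_top (by omega),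
        add_comm 1 n]
      push_cast
      ring
  have h := partial_sum (p - 1)
  rw [h3 1 le_rfl, Nat.cast_sub (by omega : 1 ≤ p)] at h
  have hne : (p : ℤ) - 1 ≠ 0 := by omega
  have : (∑ j ∈ Finset.Icc 1 (p - 1), (s j : ℤ)) = (p : ℤ) + 1 := by
    apply mul_right_cancel₀ hne
    push_cast at h
    linarith
  exact_mod_cast this

/-- A single step of a heat cycle away from a high point raises the filtration by `p + 1`, so a
run starting at a value congruent to `c + 2` stays off `c` for `p - 2` steps. -/
theorem ascent_modEq (p : ℕ) (Ω : ℕ → ℤ) (c : ℤ)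
    (hstep : ∀ j, 1 ≤ j → ¬ Ω j ≡ c [ZMOD p] → Ω (j + 1) = Ω j + ((p : ℤ) + 1))
    (j : ℕ) (hj : 1 ≤ j) (hΩ : Ω j ≡ c + 2 [ZMOD p]) (k : ℕ) (hk : k + 2 ≤ p) :
    Ω (j + k) ≡ c + 2 + k [ZMOD p] := by
  induction k with
  | zero => simpa using hΩ
  | succ k ih =>
    have ih := ih (by omega)
    have hnot : ¬ Ω (j + k) ≡ c [ZMOD p] := by
      intro hc
      have hd := (hc.symm.trans ih).dvd
      have := Int.le_of_dvd (by omega) hd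
      omega
    rw [← add_assoc, hstep _ (by omega) hnot]
    have := (ih.add_right 1).add (Int.modEq_zero_iff_dvd.2 (dvd_refl (p : ℤ)))
    convert this using 1 <;> push_cast <;> ring

theorem stmt_8 (p : ℕ) (hp : p.Prime) (hp5 : 5 ≤ p)
    (Ω : ℕ → ℤ) (s : ℕ → ℕ)
    (h1 : ∀ j, 1 ≤ j → Ω (j + 1) = Ω j + ((p : ℤ) + 1) - (s j : ℤ) * ((p : ℤ) - 1))
    (h2 : ∀ j, 1 ≤ j → (1 ≤ s j ↔ Ω j ≡ (((p + 1) / 2 : ℕ) : ℤ) [ZMOD (p : ℤ)]))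
    (h3 : ∀ j, 1 ≤ j → Ω (j + (p - 1)) = Ω j) :
    ((Finset.filter (fun j => Ω j ≡ (((p + 1) / 2 : ℕ) : ℤ) [ZMOD (p : ℤ)])
          (Finset.Icc 1 (p - 1))).card = 1
        ↔ ∃ j, 1 ≤ j ∧ Ω j ≡ (((p + 5) / 2 : ℕ) : ℤ) [ZMOD (p : ℤ)]) ∧
    (∀ j, 2 ≤ j → Ω j ≡ (((p + 5) / 2 : ℕ) : ℤ) [ZMOD (p : ℤ)] →
        Ω (j - 1) ≡ (((p + 1) / 2 : ℕ) : ℤ) [ZMOD (p : ℤ)]) := by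
  have hc : (((p + 5) / 2 : ℕ) : ℤ) = (((p + 1) / 2 : ℕ) : ℤ) + 2 := by omega
  rw [hc]
  generalize (((p + 1) / 2 : ℕ) : ℤ) = c at h2 ⊢
  have hstep : ∀ j, 1 ≤ j → ¬ Ω j ≡ c [ZMOD p] → Ω (j + 1) = Ω j + ((p : ℤ) + 1) := by
    intro j hj hn
    have hs : s j = 0 := by
      have := mt (h2 j hj).1 hn
      omega
    simpa [hs] using h1 j hj
  have hasc := ascent_modEq p Ω c hstep
  have hlast : ∀ j, 1 ≤ j → Ω j ≡ c + 2 [ZMOD p] → Ω (j + (p - 2)) ≡ c [ZMOD p] := by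
    intro j hj hΩ
    refine (hasc j hj hΩ (p - 2) (by omega)).trans ?_
    rw [show c + 2 + ((p - 2 : ℕ) : ℤ) = c + p by omega]
    simp
  refine ⟨⟨fun hcard => ?_, ?_⟩, fun j hj hΩ => ?_⟩
  · obtain ⟨i, hi⟩ := Finset.card_eq_one.1 hcard
    have hmem : i ∈ Finset.Icc 1 (p - 1) ∧ Ω i ≡ c [ZMOD p] := by
      rw [← Finset.mem_filter (p := fun j => Ω j ≡ c [ZMOD p]), hi]
      exact Finset.mem_singleton_self i
    obtain ⟨hiI, hhigh⟩ := hmem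
    have hi1 := (Finset.mem_Icc.1 hiI).1
    have hs : s i = p + 1 := by
      rw [← sum_drops_eq p (by omega) Ω s h1 h3]
      refine (Finset.sum_eq_single_of_mem i hiI fun j hj hne => ?_).symm
      by_contra h0
      refine hne (Finset.mem_singleton.1 ?_)
      rw [← hi]
      exact Finset.mem_filter.2
        ⟨hj, (h2 j (Finset.mem_Icc.1 hj).1).1 (Nat.one_le_iff_ne_zero.2 h0)⟩
    refine ⟨i + 1, by omega, ?_⟩
    rw [h1 i hi1, hs]
    have : Ω i + ((p : ℤ) + 1) - ((p + 1 : ℕ) : ℤ) * ((p : ℤ) - 1) =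
        Ω i + 2 + p * (1 - p) := by push_cast; ring
    rw [this]
    exact (Int.modEq_add_fac_self (t := 1 - (p : ℤ))).trans (hhigh.add_right 2)
  · rintro ⟨j, hj, hΩ⟩
    rw [card_filter_Ico_eq_of_periodic_pos _ (p - 1) (fun j hj => by rw [h3 j hj]) j hj,
      Finset.card_eq_one]
    refine ⟨j + (p - 2), ?_⟩
    ext x
    simp only [Finset.mem_filter, Finset.mem_Ico, Finset.mem_singleton]
    constructor
    · rintro ⟨⟨hjx, hx⟩, hhigh⟩
      obtain ⟨k, rfl⟩ := Nat.exists_eq_add_of_le hjx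
      have hd := (hhigh.symm.trans (hasc j hj hΩ k (by omega))).dvd
      have := Int.le_of_dvd (by omega) hd
      omega
    · rintro rfl
      exact ⟨⟨by omega, by omega⟩, hlast j hj hΩ⟩
  · have := hlast j (by omega) hΩ
    rwa [show j + (p - 2) = j - 1 + (p - 1) by omega, h3 (j - 1) (by omega)] at this
end

section
/- Let p ≥ 5 be a prime and (Ω, s) a heat-cycle datum. Then for every j ≥ 1, Ω(j+1) ≠ Ω(j) + 2. (Lemma 2.5, part 3.) -/
theorem stmt_9 (p : ℕ) (hp : p.Prime) (hp5 : 5 ≤ p)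
    (Ω : ℕ → ℤ) (s : ℕ → ℕ)
    (h1 : ∀ j, 1 ≤ j → Ω (j + 1) = Ω j + ((p : ℤ) + 1) - (s j : ℤ) * ((p : ℤ) - 1))
    (h2 : ∀ j, 1 ≤ j → (1 ≤ s j ↔ Ω j ≡ (((p + 1) / 2 : ℕ) : ℤ) [ZMOD (p : ℤ)]))
    (h3 : ∀ j, 1 ≤ j → Ω (j + (p - 1)) = Ω j) :
    ∀ j, 1 ≤ j → Ω (j + 1) ≠ Ω j + 2 := by
  intro j hj hstep
  have hhigh : Ω j ≡ (((p + 1) / 2 : ℕ) : ℤ) [ZMOD (p : ℤ)] := by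
    refine (h2 j hj).1 (Nat.one_le_iff_ne_zero.2 fun h0 => ?_)
    have h := h1 j hj
    rw [h0] at h
    push_cast at h
    omega
  -- After a step of `+2` there is no further high point before the period closes.
  have hrun : ∀ k : ℕ, k + 2 ≤ p → Ω (j + 1 + k) = Ω j + 2 + k * ((p : ℤ) + 1) := by
    intro k
    induction k with
    | zero => intro _; simpa using hstep
    | succ k ih =>
      intro hk
      have hΩ := ih (by omega)
      have hs : s (j + 1 + k) = 0 := by
        by_contra hne
        have hmod := (h2 (j + 1 + k) (by omega)).1 (Nat.one_le_iff_ne_zero.2 hne)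
        have hdvd := (hhigh.trans hmod.symm).dvd
        rw [hΩ, show Ω j + 2 + k * ((p : ℤ) + 1) - Ω j = (2 + k : ℤ) + p * k by ring,
          dvd_add_left (dvd_mul_right _ _)] at hdvd
        have := Int.le_of_dvd (by omega) hdvd
        omega
      have h := h1 (j + 1 + k) (by omega)
      rw [hs, hΩ] at h
      rw [← add_assoc, h]
      push_cast
      ring
  have hend := hrun (p - 2) (by omega)
  rw [show j + 1 + (p - 2) = j + (p - 1) by omega, h3 j hj] at hend
  have : (0 : ℤ) ≤ ((p - 2 : ℕ) : ℤ) * ((p : ℤ) + 1) := by positivity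
  omega
end

section
/- Let p ≥ 5 be a prime and (Ω, s) a heat-cycle datum. Then for every i ≥ 1, the number of high points among the p−1 consecutive indices {i, i+1, …, i+p−2} is either 1 or 2. (Lemma 2.5, part 4: the heat cycle has one or two high points.) -/
/-- If `y = x + (p + 1) - s (p - 1)`, then passing from `x` to `y` lowers the residue of the distance
to `h` modulo `p` by at most `1 + s`, with a gain of at least `p` when `x ≡ h`. -/
theorem heat_step_emod_le {p x y h s : ℤ} (hp : 0 < p) (hs : 0 ≤ s)
    (hy : y = x + (p + 1) - s * (p - 1)) :
    p * (if x ≡ h [ZMOD p] then 1 else 0) ≤ ((h - y) % p - (h - x) % p) + (1 + s) := by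
  have hx0 := Int.emod_nonneg (h - x) hp.ne'
  have hxp := Int.emod_lt_of_pos (h - x) hp
  have hy0 := Int.emod_nonneg (h - y) hp.ne'
  have hdx := Int.emod_add_mul_ediv (h - x) p
  have hdy := Int.emod_add_mul_ediv (h - y) p
  obtain ⟨m, hm⟩ : p ∣ ((h - y) % p - (h - x) % p) + (1 + s) :=
    ⟨(h - x) / p - (h - y) / p + s - 1, by linear_combination hdy - hdx - hy⟩
  rw [hm]
  refine mul_le_mul_of_nonneg_left ?_ hp.le
  split_ifs with hxh
  · have : (h - x) % p = 0 := Int.emod_eq_zero_of_dvd hxh.dvd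
    by_contra! hlt
    nlinarith
  · by_contra! hlt
    nlinarith

theorem stmt_10 (p : ℕ) (hp : p.Prime) (hp5 : 5 ≤ p)
    (Ω : ℕ → ℤ) (s : ℕ → ℕ)
    (h1 : ∀ j, 1 ≤ j → Ω (j + 1) = Ω j + ((p : ℤ) + 1) - (s j : ℤ) * ((p : ℤ) - 1))
    (h2 : ∀ j, 1 ≤ j → (1 ≤ s j ↔ Ω j ≡ (((p + 1) / 2 : ℕ) : ℤ) [ZMOD (p : ℤ)]))
    (h3 : ∀ j, 1 ≤ j → Ω (j + (p - 1)) = Ω j) :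
    ∀ i, 1 ≤ i →
      (Finset.filter (fun j => Ω j ≡ (((p + 1) / 2 : ℕ) : ℤ) [ZMOD (p : ℤ)])
          (Finset.Icc i (i + p - 2))).card = 1 ∨
      (Finset.filter (fun j => Ω j ≡ (((p + 1) / 2 : ℕ) : ℤ) [ZMOD (p : ℤ)])
          (Finset.Icc i (i + p - 2))).card = 2 := by
  intro i hi
  generalize (((p + 1) / 2 : ℕ) : ℤ) = h at h2 ⊢
  have hIcc : Finset.Icc i (i + p - 2) = Finset.Ico i (i + (p - 1)) := by
    ext j
    simp only [Finset.mem_Icc, Finset.mem_Ico]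
    omega
  rw [hIcc]
  have hi1 : ∀ j ∈ Finset.Ico i (i + (p - 1)), 1 ≤ j := fun j hj =>
    hi.trans (Finset.mem_Ico.mp hj).1
  have hcast : ((p - 1 : ℕ) : ℤ) = (p : ℤ) - 1 := by push_cast [show 1 ≤ p by omega]; rfl
  have hpz : (5 : ℤ) ≤ p := by exact_mod_cast hp5
  have hsum : ∑ j ∈ Finset.Ico i (i + (p - 1)), (s j : ℤ) = p + 1 := by
    have htel := Finset.sum_Ico_sub Ω (Nat.le_add_right i (p - 1))
    rw [Finset.sum_congr rfl fun j hj => show Ω (j + 1) - Ω j = (p + 1) - s j * (p - 1) by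
      rw [h1 j (hi1 j hj)]; ring, Finset.sum_sub_distrib, ← Finset.sum_mul, h3 i hi] at htel
    simp only [Finset.sum_const, Nat.card_Ico, add_tsub_cancel_left, nsmul_eq_mul, hcast] at htel
    have : (p : ℤ) - 1 ≠ 0 := by omega
    exact mul_right_cancel₀ this (by linear_combination -htel)
  have hle : (Finset.filter (fun j => Ω j ≡ h [ZMOD (p : ℤ)])
      (Finset.Ico i (i + (p - 1)))).card ≤ 2 := by
    have hstep := Finset.sum_le_sum fun j hj =>
      heat_step_emod_le (h := h) (by omega) (Int.natCast_nonneg (s j)) (h1 j (hi1 j hj))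
    rw [← Finset.mul_sum, Finset.sum_boole, Finset.sum_add_distrib, Finset.sum_add_distrib, hsum,
      Finset.sum_Ico_sub (fun j => (h - Ω j) % p) (Nat.le_add_right i (p - 1)), h3 i hi] at hstep
    simp only [Finset.sum_const, Nat.card_Ico, add_tsub_cancel_left, nsmul_eq_mul, hcast] at hstep
    zify
    exact le_of_mul_le_mul_left (by linarith) (show (0 : ℤ) < p by omega)
  have hpos : 0 < (Finset.filter (fun j => Ω j ≡ h [ZMOD (p : ℤ)])
      (Finset.Ico i (i + (p - 1)))).card := by
    obtain ⟨j, hj, hsj⟩ : ∃ j ∈ Finset.Ico i (i + (p - 1)), (s j : ℤ) ≠ 0 :=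
      Finset.exists_ne_zero_of_sum_ne_zero (by omega)
    exact Finset.card_pos.mpr
      ⟨j, Finset.mem_filter.mpr ⟨hj, (h2 j (hi1 j hj)).mp (by omega)⟩⟩
  omega
end

section
/- Let p ≥ 5 be a prime and (Ω, s) a heat-cycle datum. If i ≥ 1 is a high point with s(i) ≤ p − 1, and i' > i is the smallest high point greater than i, then i' − i = p − s(i). (This is the spacing relation i_{j+1} − i_j = p − s_j between consecutive high points established in the proof of Lemma 2.5, part 4.) -/
/-- If the filtration drops by `s i * (p - 1)` at `i` and there is no further drop strictly between
`i` and `i + k + 1`, then it has grown by `(k + 1) * (p + 1)` apart from the drop at `i`. -/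
theorem filtration_after_drop {p : ℤ} {Ω : ℕ → ℤ} {s : ℕ → ℕ}
    (step : ∀ j, 1 ≤ j → Ω (j + 1) = Ω j + (p + 1) - (s j : ℤ) * (p - 1))
    {i : ℕ} (hi : 1 ≤ i) (k : ℕ) (hs : ∀ j, i < j → j < i + k + 1 → s j = 0) :
    Ω (i + k + 1) = Ω i + (k + 1) * (p + 1) - s i * (p - 1) := by
  induction k with
  | zero => simpa using step i hi
  | succ k ih =>
    have prev := ih fun j hij hj => hs j hij (by omega)
    have next := step (i + k + 1) (by omega)
    rw [hs (i + k + 1) (by omega) (by omega), prev] at next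
    rw [← add_assoc i k 1, next]
    push_cast
    ring

theorem stmt_11 (p : ℕ) (hp : p.Prime) (hp5 : 5 ≤ p)
    (Ω : ℕ → ℤ) (s : ℕ → ℕ)
    (h1 : ∀ j, 1 ≤ j → Ω (j + 1) = Ω j + ((p : ℤ) + 1) - (s j : ℤ) * ((p : ℤ) - 1))
    (h2 : ∀ j, 1 ≤ j → (1 ≤ s j ↔ Ω j ≡ (((p + 1) / 2 : ℕ) : ℤ) [ZMOD (p : ℤ)]))
    (h3 : ∀ j, 1 ≤ j → Ω (j + (p - 1)) = Ω j)
    (i i' : ℕ) (hi : 1 ≤ i)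
    (hhigh : Ω i ≡ (((p + 1) / 2 : ℕ) : ℤ) [ZMOD (p : ℤ)])
    (hsi : s i ≤ p - 1)
    (hii' : i < i')
    (hhigh' : Ω i' ≡ (((p + 1) / 2 : ℕ) : ℤ) [ZMOD (p : ℤ)])
    (hmin : ∀ j, i < j → Ω j ≡ (((p + 1) / 2 : ℕ) : ℤ) [ZMOD (p : ℤ)] → i' ≤ j) :
    (i' : ℤ) - (i : ℤ) = (p : ℤ) - (s i : ℤ) := by
  have drop_pos : 1 ≤ s i := (h2 i hi).2 hhigh
  have no_drop : ∀ j, i < j → j < i' → s j = 0 := by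
    intro j hij hj
    by_contra h
    exact absurd (hmin j hij ((h2 j (by omega)).1 (by omega))) (by omega)
  have high_iff : ∀ k : ℕ, i + k + 1 ≤ i' →
      (Ω (i + k + 1) ≡ (((p + 1) / 2 : ℕ) : ℤ) [ZMOD (p : ℤ)] ↔ p ∣ s i + k + 1) := by
    intro k hk
    have value := filtration_after_drop h1 hi k fun j hij hj => no_drop j hij (by omega)
    have shift : Ω (i + k + 1) ≡ Ω i + (s i + k + 1 : ℕ) [ZMOD (p : ℤ)] := by
      refine Int.modEq_iff_dvd.2 ⟨s i - (k + 1), ?_⟩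
      rw [value]
      push_cast
      ring
    rw [← Int.natCast_dvd_natCast, ← Int.modEq_zero_iff_dvd]
    constructor
    · intro h
      exact Int.ModEq.add_left_cancel' (Ω i) (by simpa using shift.symm.trans (h.trans hhigh.symm))
    · intro h
      exact shift.trans (by simpa using hhigh.add h)
  obtain ⟨k, rfl⟩ : ∃ k, i' = i + k + 1 := ⟨i' - i - 1, by omega⟩
  have lower : p ≤ s i + k + 1 := Nat.le_of_dvd (by omega) ((high_iff k le_rfl).1 hhigh')
  have upper : s i + k + 1 ≤ p := by
    have h := (high_iff (p - s i - 1) (by omega)).2 (by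
      rw [show s i + (p - s i - 1) + 1 = p by omega])
    have := hmin _ (by omega) h
    omega
  push_cast
  omega
end

section
/- Let p ≥ 5 be a prime and (Ω, s) a heat-cycle datum satisfying in addition Ω((p+1)/2) = Ω(1). Then there are exactly two high points among the indices {1, 2, …, p−1}, and every low point j satisfies Ω(j) ≡ 2 (mod p). (This is the combinatorial content of Corollary 2.6: if φ has a Ramanujan-type congruence at some b ≢ 0 (mod p), so that Ω(L_m^((p+1)/2)φ) = Ω(L_m φ), then the heat cycle of φ has two low points, both of filtration ≡ 2 (mod p).) -/
/-- Telescoped form of the recursion for the filtrations. -/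
lemma filtration_add {p : ℕ} {Ω : ℕ → ℤ} {s : ℕ → ℕ}
    (h1 : ∀ j, 1 ≤ j → Ω (j + 1) = Ω j + ((p : ℤ) + 1) - (s j : ℤ) * ((p : ℤ) - 1))
    {a : ℕ} (ha : 1 ≤ a) (n : ℕ) :
    Ω (a + n) = Ω a + n * ((p : ℤ) + 1)
      - ((∑ i ∈ Finset.range n, s (a + i) : ℕ) : ℤ) * ((p : ℤ) - 1) := by
  induction n with
  | zero => simp
  | succ n ih =>
    rw [← add_assoc, h1 _ (by omega), ih, Finset.sum_range_succ]
    push_cast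
    ring

/-- If the drop `s i` at a high point `i` is at most `k + 1`, where `p = 2 * k + 1`, then none of
the next `k - 1` indices is a high point. -/
lemma no_high_point_after {p k : ℕ} (hk : p = 2 * k + 1) {Ω : ℕ → ℤ} {s : ℕ → ℕ}
    (h1 : ∀ j, 1 ≤ j → Ω (j + 1) = Ω j + ((p : ℤ) + 1) - (s j : ℤ) * ((p : ℤ) - 1))
    (h2 : ∀ j, 1 ≤ j → (1 ≤ s j ↔ Ω j ≡ ((k + 1 : ℕ) : ℤ) [ZMOD (p : ℤ)]))
    {i : ℕ} (hi : 1 ≤ i) (hs : 1 ≤ s i) (hsk : s i ≤ k + 1) (d : ℕ) (hd : d + 1 < k) :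
    s (i + (d + 1)) = 0 := by
  have hzero : ∀ d, d + 1 < k → Ω (i + (d + 1)) ≡ Ω i + s i + (d + 1 : ℕ) [ZMOD (p : ℤ)] →
      s (i + (d + 1)) = 0 := fun d hd hmod => by
    by_contra hne
    have hhigh := (h2 (i + (d + 1)) (by omega)).1 (by omega)
    have hdvd := (((h2 i hi).1 hs).trans (hhigh.symm.trans hmod)).dvd
    rw [show Ω i + s i + ((d + 1 : ℕ) : ℤ) - Ω i = ((s i + (d + 1) : ℕ) : ℤ) by
      push_cast; ring, Int.natCast_dvd_natCast] at hdvd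
    have := Nat.le_of_dvd (by omega) hdvd
    omega
  have hmod : Ω (i + (d + 1)) ≡ Ω i + s i + (d + 1 : ℕ) [ZMOD (p : ℤ)] := by
    induction d with
    | zero =>
      rw [Int.modEq_iff_dvd]
      refine ⟨s i - 1, ?_⟩
      rw [zero_add, h1 i hi]
      push_cast
      ring
    | succ d ih =>
      have hprev := ih (by omega)
      rw [← add_assoc, h1 _ (by omega), hzero d (by omega) hprev]
      rw [Int.modEq_iff_dvd] at hprev ⊢
      obtain ⟨c, hc⟩ := hprev
      refine ⟨c - 1, ?_⟩
      push_cast at hc ⊢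
      linear_combination hc
  exact hzero d hd hmod

/-- A window of length `k = (p - 1) / 2` over which the filtration returns to its initial value
contains exactly one high point, and the drop there is `k + 1`. -/
lemma exists_unique_high_point {p k : ℕ} (hk : p = 2 * k + 1) (hk0 : 0 < k)
    {Ω : ℕ → ℤ} {s : ℕ → ℕ}
    (h1 : ∀ j, 1 ≤ j → Ω (j + 1) = Ω j + ((p : ℤ) + 1) - (s j : ℤ) * ((p : ℤ) - 1))
    (h2 : ∀ j, 1 ≤ j → (1 ≤ s j ↔ Ω j ≡ ((k + 1 : ℕ) : ℤ) [ZMOD (p : ℤ)]))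
    {a : ℕ} (ha : 1 ≤ a) (hret : Ω (a + k) = Ω a) :
    ∃ i < k, s (a + i) = k + 1 ∧ ∀ j < k, 1 ≤ s (a + j) → j = i := by
  have hsum : ∑ i ∈ Finset.range k, s (a + i) = k + 1 := by
    have h := filtration_add h1 ha k
    rw [hret, hk] at h
    generalize ∑ i ∈ Finset.range k, s (a + i) = S at h ⊢
    have hk' : (2 * k : ℤ) ≠ 0 := by positivity
    have : (S : ℤ) = k + 1 := by
      apply mul_right_cancel₀ hk'
      push_cast at h
      linear_combination h
    exact_mod_cast this
  have hle : ∀ i < k, s (a + i) ≤ k + 1 := fun i hi => by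
    rw [← hsum]
    exact Finset.single_le_sum (f := fun i => s (a + i)) (fun _ _ => Nat.zero_le _)
      (Finset.mem_range.2 hi)
  have hlt : ∀ i j, i < j → j < k → 1 ≤ s (a + i) → ¬ 1 ≤ s (a + j) := fun i j hij hj hs => by
    have h := no_high_point_after hk h1 h2 (by omega) hs (hle i (by omega))
      (j - i - 1) (by omega)
    rw [show a + i + (j - i - 1 + 1) = a + j by omega] at h
    omega
  obtain ⟨i, hi, hsi⟩ : ∃ i ∈ Finset.range k, s (a + i) ≠ 0 :=
    Finset.exists_ne_zero_of_sum_ne_zero (by omega)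
  rw [Finset.mem_range] at hi
  have huniq : ∀ j < k, 1 ≤ s (a + j) → j = i := fun j hj hsj => by
    rcases lt_trichotomy i j with h | h | h
    · exact absurd hsj (hlt i j h hj (by omega))
    · exact h.symm
    · exact absurd (by omega) (hlt j i h hi hsj)
  refine ⟨i, hi, ?_, huniq⟩
  rw [← hsum]
  refine (Finset.sum_eq_single_of_mem (f := fun j => s (a + j)) i (Finset.mem_range.2 hi)
    fun j hj hji => ?_).symm
  by_contra hne
  exact hji (huniq j (Finset.mem_range.1 hj) (Nat.one_le_iff_ne_zero.2 hne))

theorem stmt_13 (p : ℕ) (hp : p.Prime) (hp5 : 5 ≤ p)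
    (Ω : ℕ → ℤ) (s : ℕ → ℕ)
    (h1 : ∀ j, 1 ≤ j → Ω (j + 1) = Ω j + ((p : ℤ) + 1) - (s j : ℤ) * ((p : ℤ) - 1))
    (h2 : ∀ j, 1 ≤ j → (1 ≤ s j ↔ Ω j ≡ (((p + 1) / 2 : ℕ) : ℤ) [ZMOD (p : ℤ)]))
    (h3 : ∀ j, 1 ≤ j → Ω (j + (p - 1)) = Ω j)
    (h4 : Ω ((p + 1) / 2) = Ω 1) :
    (Finset.filter (fun j => Ω j ≡ (((p + 1) / 2 : ℕ) : ℤ) [ZMOD (p : ℤ)])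
        (Finset.Icc 1 (p - 1))).card = 2 ∧
    (∀ j, 2 ≤ j → Ω (j - 1) ≡ (((p + 1) / 2 : ℕ) : ℤ) [ZMOD (p : ℤ)] →
        Ω j ≡ 2 [ZMOD (p : ℤ)]) := by
  obtain ⟨k, hk⟩ : ∃ k, p = 2 * k + 1 := hp.odd_of_ne_two (by omega)
  have hk0 : 0 < k := by omega
  rw [show (p + 1) / 2 = k + 1 by omega] at h2 h4 ⊢
  have hper : ∀ m, Ω (1 + m * k) = Ω 1 ∧ Ω (1 + (m + 1) * k) = Ω 1 := fun m => by
    induction m with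
    | zero => simpa [add_comm] using h4
    | succ m ih =>
      refine ⟨ih.2, ?_⟩
      rw [show 1 + (m + 1 + 1) * k = 1 + m * k + (p - 1) by
        rw [hk, Nat.add_sub_cancel]; ring, h3 _ (by omega), ih.1]
  have hwin : ∀ m, ∃ i < k, s (1 + m * k + i) = k + 1 ∧
      ∀ j < k, 1 ≤ s (1 + m * k + j) → j = i := fun m =>
    exists_unique_high_point hk hk0 h1 h2 (by omega) (by
      rw [(hper m).1, ← (hper m).2]
      congr 1
      ring)
  constructor
  · obtain ⟨i, hi, hsi, hui⟩ := hwin 0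
    obtain ⟨j, hj, hsj, huj⟩ := hwin 1
    simp only [zero_mul, add_zero, one_mul] at hsi hui hsj huj
    rw [Finset.card_eq_two]
    refine ⟨1 + i, 1 + k + j, by omega, ?_⟩
    ext x
    simp only [Finset.mem_filter, Finset.mem_Icc, Finset.mem_insert, Finset.mem_singleton]
    constructor
    · rintro ⟨⟨hx1, hx2⟩, hx⟩
      have hsx := (h2 x hx1).2 hx
      by_cases hxk : x ≤ k
      · have := hui (x - 1) (by omega) (by rwa [show 1 + (x - 1) = x by omega])
        omega
      · have := huj (x - 1 - k) (by omega) (by rwa [show 1 + k + (x - 1 - k) = x by omega])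
        omega
    · rintro (rfl | rfl)
      · exact ⟨by omega, (h2 _ (by omega)).1 (by omega)⟩
      · exact ⟨by omega, (h2 _ (by omega)).1 (by omega)⟩
  · intro j hj hhigh
    obtain ⟨i, hi, hsi, hui⟩ := hwin ((j - 2) / k)
    have hdecomp : 1 + (j - 2) / k * k + (j - 2) % k = j - 1 := by
      have := Nat.div_add_mod' (j - 2) k
      omega
    have hij := hui ((j - 2) % k) (Nat.mod_lt _ hk0)
      (by rw [hdecomp]; exact (h2 _ (by omega)).2 hhigh)
    rw [← hij, hdecomp] at hsi
    have hstep := h1 (j - 1) (by omega)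
    rw [show j - 1 + 1 = j by omega, hsi] at hstep
    rw [Int.modEq_iff_dvd] at hhigh ⊢
    obtain ⟨c, hc⟩ := hhigh
    refine ⟨c + k - 1, ?_⟩
    rw [hstep]
    subst hk
    push_cast at hc ⊢
    linear_combination hc
end

section
/- Let p ≥ 5 be a prime and let a : ℕ × ℤ × ℕ → ZMod p be a formal degree-2 Fourier expansion mod p. Define a₀ := a − 𝔻^(p−1) a, a₊₁ := (1/2)·(𝔻^(p−1) a + 𝔻^((p−1)/2) a), and a₋₁ := (1/2)·(𝔻^(p−1) a − 𝔻^((p−1)/2) a), where 1/2 denotes the inverse of 2 in ZMod p. Then for each s ∈ {0, 1, −1} and every (n,r,m): a_s(n,r,m) = a(n,r,m) if legendreSym p (4nm − r²) = s, and a_s(n,r,m) = 0 otherwise. (This is formula (Fs) of Section 3.) -/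
theorem stmt_14 (p : ℕ) [Fact p.Prime] (hp5 : 5 ≤ p)
    (a aZero aPos aNeg : ℕ × ℤ × ℕ → ZMod p)
    (hZero : ∀ t, aZero t = a t - (thetaOp p)^[p - 1] a t)
    (haPos : ∀ t, aPos t =
      (2 : ZMod p)⁻¹ * ((thetaOp p)^[p - 1] a t + (thetaOp p)^[(p - 1) / 2] a t))
    (haNeg : ∀ t, aNeg t =
      (2 : ZMod p)⁻¹ * ((thetaOp p)^[p - 1] a t - (thetaOp p)^[(p - 1) / 2] a t)) :
    ∀ (n : ℕ) (r : ℤ) (m : ℕ),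
      (aZero (n, r, m) =
        if legendreSym p (4 * (n : ℤ) * (m : ℤ) - r ^ 2) = 0 then a (n, r, m) else 0) ∧
      (aPos (n, r, m) =
        if legendreSym p (4 * (n : ℤ) * (m : ℤ) - r ^ 2) = 1 then a (n, r, m) else 0) ∧
      (aNeg (n, r, m) =
        if legendreSym p (4 * (n : ℤ) * (m : ℤ) - r ^ 2) = -1 then a (n, r, m) else 0) := by
  intro n r m
  have hodd : p % 2 = 1 := (Fact.out : p.Prime).eq_two_or_odd.resolve_left (by lia)
  have hhalf : (p - 1) / 2 = p / 2 := by lia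
  have hdouble : p - 1 = p / 2 * 2 := by lia
  have htwo : (2 : ZMod p) ≠ 0 := Ring.two_ne_zero (by rw [ZMod.ringChar_zmod_n]; lia)
  rw [hZero, haPos, haNeg]
  simp only [thetaOp_iterate_apply, hhalf]
  rw [hdouble, pow_mul]
  generalize 4 * (n : ℤ) * (m : ℤ) - r ^ 2 = d
  rw [← legendreSym.eq_pow]
  have hcases : legendreSym p d = 0 ∨ legendreSym p d = 1 ∨ legendreSym p d = -1 := by
    by_cases hd : (d : ZMod p) = 0
    · exact Or.inl ((legendreSym.eq_zero_iff p d).2 hd)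
    · exact Or.inr (legendreSym.eq_one_or_neg_one p hd)
  rcases hcases with h | h | h <;> rw [h] <;> norm_num <;> field_simp <;> ring
end

section
/- Let p ≥ 5 be a prime and let a : ℕ × ℤ × ℕ → ZMod p be a formal degree-2 Fourier expansion mod p. With a₀ := a − 𝔻^(p−1) a, a₊₁ := (1/2)·(𝔻^(p−1) a + 𝔻^((p−1)/2) a), and a₋₁ := (1/2)·(𝔻^(p−1) a − 𝔻^((p−1)/2) a) (where 1/2 is the inverse of 2 in ZMod p), one has a = a₀ + a₊₁ + a₋₁, and for each s ∈ {0, 1, −1} the function a_s has a Ramanujan-type congruence at every b ∈ ZMod p such that legendreSym p b ≠ s. (This is the construction at the end of Section 3 producing Siegel modular forms with Ramanujan-type congruences.) -/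
theorem legendreSym_trichotomy (p : ℕ) [Fact p.Prime] (c : ℤ) :
    legendreSym p c = 0 ∨ legendreSym p c = 1 ∨ legendreSym p c = -1 := by
  by_cases hc : (c : ZMod p) = 0
  · exact Or.inl ((legendreSym.eq_zero_iff p c).2 hc)
  · exact Or.inr (legendreSym.eq_one_or_neg_one p hc)

theorem pow_pred_half_eq_legendreSym {p : ℕ} [Fact p.Prime] (hp : p ≠ 2) (b : ZMod p) :
    b ^ ((p - 1) / 2) = (legendreSym p (b.val : ℤ) : ZMod p) := by
  have hodd := (Fact.out : p.Prime).eq_two_or_odd.resolve_left hp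
  rw [legendreSym.eq_pow, show (p - 1) / 2 = p / 2 by omega]
  simp

theorem pow_pred_eq_legendreSym_sq {p : ℕ} [Fact p.Prime] (hp : p ≠ 2) (b : ZMod p) :
    b ^ (p - 1) = (legendreSym p (b.val : ℤ) : ZMod p) ^ 2 := by
  have hodd := (Fact.out : p.Prime).eq_two_or_odd.resolve_left hp
  rw [← pow_pred_half_eq_legendreSym hp, ← pow_mul, show (p - 1) / 2 * 2 = p - 1 by omega]

theorem stmt_15 (p : ℕ) [Fact p.Prime] (hp5 : 5 ≤ p)
    (a aZero aPos aNeg : ℕ × ℤ × ℕ → ZMod p)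
    (hZero : ∀ t, aZero t = a t - (thetaOp p)^[p - 1] a t)
    (haPos : ∀ t, aPos t =
      (2 : ZMod p)⁻¹ * ((thetaOp p)^[p - 1] a t + (thetaOp p)^[(p - 1) / 2] a t))
    (haNeg : ∀ t, aNeg t =
      (2 : ZMod p)⁻¹ * ((thetaOp p)^[p - 1] a t - (thetaOp p)^[(p - 1) / 2] a t)) :
    (∀ t, a t = aZero t + aPos t + aNeg t) ∧
    (∀ b : ZMod p, legendreSym p (b.val : ℤ) ≠ 0 →
      ∀ (n : ℕ) (r : ℤ) (m : ℕ),
        ((4 * (n : ℤ) * (m : ℤ) - r ^ 2 : ℤ) : ZMod p) = b → aZero (n, r, m) = 0) ∧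
    (∀ b : ZMod p, legendreSym p (b.val : ℤ) ≠ 1 →
      ∀ (n : ℕ) (r : ℤ) (m : ℕ),
        ((4 * (n : ℤ) * (m : ℤ) - r ^ 2 : ℤ) : ZMod p) = b → aPos (n, r, m) = 0) ∧
    (∀ b : ZMod p, legendreSym p (b.val : ℤ) ≠ -1 →
      ∀ (n : ℕ) (r : ℤ) (m : ℕ),
        ((4 * (n : ℤ) * (m : ℤ) - r ^ 2 : ℤ) : ZMod p) = b → aNeg (n, r, m) = 0) := by
  have hp : p ≠ 2 := by omega
  have h2 : (2 : ZMod p) ≠ 0 := Ring.two_ne_zero (by rwa [ZMod.ringChar_zmod_n])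
  refine ⟨fun t => ?_, fun b hb n r m h => ?_, fun b hb n r m h => ?_, fun b hb n r m h => ?_⟩
  · rw [hZero, haPos, haNeg]
    field_simp
    ring
  · rw [hZero, thetaOp_iterate_apply, h, pow_pred_eq_legendreSym_sq hp]
    rcases legendreSym_trichotomy p b.val with h' | h' | h' <;> simp_all
  · rw [haPos, thetaOp_iterate_apply, thetaOp_iterate_apply, h, pow_pred_eq_legendreSym_sq hp,
      pow_pred_half_eq_legendreSym hp]
    rcases legendreSym_trichotomy p b.val with h' | h' | h' <;> simp_all
  · rw [haNeg, thetaOp_iterate_apply, thetaOp_iterate_apply, h, pow_pred_eq_legendreSym_sq hp,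
      pow_pred_half_eq_legendreSym hp]
    rcases legendreSym_trichotomy p b.val with h' | h' | h' <;> simp_all
end
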